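/- Let α be a simple root such that h_{ω_α} = 1 (i.e. ⟨ω_α,β∨⟩ ≤ 1 for all roots β). Let w̃₂ ∈ W̃₁ and let ω ∈ X be such that (s_α w̃₂)^⋄ = t_ω s_α w̃₂ ∈ W̃₁. Then the factorization (s_α w̃₂)^{⋄,−1} · ((s_α w̃₂)^⋄ w̃₂⁻¹ s_α w₀) of w̃₂⁻¹ s_α w₀ is reduced, i.e. ℓ(w̃₂⁻¹ s_α w₀) = ℓ((s_α w̃₂)^{⋄,−1}) + ℓ((s_α w̃₂)^⋄ w̃₂⁻¹ s_α w₀). -/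

import Mathlib

open scoped Classical Pointwise

namespace SerrePaper

variable (V : Type) [AddCommGroup V] [Module ℝ V]

/-- The combinatorial context of the paper: the character lattice `X` of a split maximal
torus, sitting inside the real vector space `V = X ⊗ ℝ`, together with a reduced
crystallographic root system `R` with positive roots `Rpos`, simple roots `Δ`,
the coroot pairing `coroot α = ⟨·, α∨⟩`, the weight `η` pairing to `1` with every simple
coroot, and the longest element `w0` of the Weyl group. -/
structure Ctx where
  R : Finset V
  Rpos : Finset V
  Δ : Finset V
  coroot : V → V →ₗ[ℝ] ℝ
  eta : V
  w0 : V ≃ₗ[ℝ] V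
  X : AddSubgroup V
  pos_subset : Rpos ⊆ R
  simple_subset : Δ ⊆ Rpos
  root_ne_zero : ∀ α ∈ R, α ≠ (0 : V)
  neg_mem : ∀ α ∈ R, -α ∈ R
  pos_or_neg : ∀ α ∈ R, α ∈ Rpos ∨ -α ∈ Rpos
  pos_not_neg : ∀ α ∈ Rpos, -α ∉ Rpos
  coroot_self : ∀ α ∈ R, coroot α α = 2
  coroot_neg : ∀ α ∈ R, coroot (-α) = -coroot α
  crystallographic : ∀ α ∈ R, ∀ β ∈ R, ∃ n : ℤ, coroot α β = (n : ℝ)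
  reduced : ∀ α ∈ R, ∀ c : ℝ, c • α ∈ R → c = 1 ∨ c = -1
  reflect_root : ∀ α ∈ R, ∀ β ∈ R, β - coroot α β • α ∈ R
  reflect_coroot : ∀ α ∈ R, ∀ β ∈ R, ∀ x : V,
    coroot (β - coroot α β • α) x = coroot β x - coroot β α * coroot α x
  pos_sum_simple : ∀ α ∈ Rpos, ∃ c : V → ℕ, α = ∑ β ∈ Δ, (c β : ℝ) • β
  simple_indep : LinearIndependent ℝ (fun β : {x // x ∈ Δ} => (β : V))
  eta_pair : ∀ α ∈ Δ, coroot α eta = 1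
  root_mem_X : ∀ α ∈ R, α ∈ X
  eta_mem_X : eta ∈ X
  coroot_int : ∀ α ∈ R, ∀ x ∈ X, ∃ n : ℤ, coroot α x = (n : ℝ)
  w0_mem : w0 ∈ Subgroup.closure {g : V ≃ₗ[ℝ] V | ∃ α ∈ R, ∀ x, g x = x - coroot α x • α}
  w0_neg : ∀ α ∈ Rpos, -(w0 α) ∈ Rpos

namespace Ctx

variable {V}
variable (S : Ctx V)

/-- The (finite) Weyl group, generated by the reflections `s_α`, `α ∈ R`. -/
def Weyl : Subgroup (V ≃ₗ[ℝ] V) :=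
  Subgroup.closure {g : V ≃ₗ[ℝ] V | ∃ α ∈ S.R, ∀ x, g x = x - S.coroot α x • α}

/-- The translation `t_ν` as an affine automorphism of `V`. -/
def trans (_S : Ctx V) (ν : V) : V ≃ᵃ[ℝ] V := AffineEquiv.constVAdd ℝ V ν

/-- A linear automorphism viewed as an affine automorphism. -/
def ofW (_S : Ctx V) (w : V ≃ₗ[ℝ] V) : V ≃ᵃ[ℝ] V := w.toAffineEquiv

/-- The extended affine Weyl group `W̃ = X ⋊ W`, realized as the set of affine
transformations of the form `t_ν ∘ w` with `ν ∈ X` and `w ∈ W`. -/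
def extAff : Set (V ≃ᵃ[ℝ] V) :=
  {g | ∃ ν ∈ S.X, ∃ w ∈ S.Weyl, g = S.trans ν * S.ofW w}

/-- The base alcove `A₀`. -/
def A0 : Set V := {x | ∀ α ∈ S.Rpos, 0 < S.coroot α x ∧ S.coroot α x < 1}

/-- The affine hyperplane `⟨·,α∨⟩ = n` separates the base alcove `A₀` from its image
`g(A₀)`. -/
def Separates (α : V) (n : ℤ) (g : V ≃ᵃ[ℝ] V) : Prop :=
  ((∀ x ∈ S.A0, S.coroot α x < (n : ℝ)) ∧ (∀ x ∈ S.A0, (n : ℝ) < S.coroot α (g x))) ∨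
  ((∀ x ∈ S.A0, (n : ℝ) < S.coroot α x) ∧ (∀ x ∈ S.A0, S.coroot α (g x) < (n : ℝ)))

/-- The length `ℓ(g)` of an element of the extended affine Weyl group: the number of
affine root hyperplanes separating `A₀` from `g(A₀)`. -/
noncomputable def len (g : V ≃ᵃ[ℝ] V) : ℕ :=
  Set.ncard {q : V × ℤ | q.1 ∈ S.Rpos ∧ S.Separates q.1 q.2 g}

/-- The set of affine reflections `s_{α,n} : x ↦ x - (⟨x,α∨⟩ - n)α`. -/
def affRefl : Set (V ≃ᵃ[ℝ] V) :=
  {g | ∃ α ∈ S.R, ∃ n : ℤ, ∀ x, g x = x - (S.coroot α x - (n : ℝ)) • α}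

/-- The Bruhat order on the extended affine Weyl group, generated by
`u < r·u` for affine reflections `r` with `ℓ(u) < ℓ(r·u)` (this fixes the
`Ω`-component, so it is the componentwise extension of the Bruhat order on `W_a`). -/
def bruhatLE : (V ≃ᵃ[ℝ] V) → (V ≃ᵃ[ℝ] V) → Prop :=
  Relation.ReflTransGen fun u w => (∃ r ∈ S.affRefl, w = r * u) ∧ S.len u < S.len w

/-- Jantzen's `↑`-order, transported to the (extended) affine Weyl group via
`w̃ ↦ w̃(A₀)`: generated by `u ↑ s_{α,n}·u` whenever `u(A₀)` lies below the hyperplane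
`⟨·,α∨⟩ = n`.  (Under the affine rescaling `λ ↦ (λ+η)/p` this is equivalent to the usual
`↑`-order on `p`-alcoves, transported via the `p`-dot action `w̃ ↦ w̃ · C₀`.) -/
def upLE : (V ≃ᵃ[ℝ] V) → (V ≃ᵃ[ℝ] V) → Prop :=
  Relation.ReflTransGen fun u w =>
    ∃ α ∈ S.Rpos, ∃ n : ℤ,
      (∀ x : V, w x = u x - (S.coroot α (u x) - (n : ℝ)) • α) ∧
      ∀ x ∈ S.A0, S.coroot α (u x) < (n : ℝ)

/-- `W̃⁺`: the elements of `W̃` taking the base alcove to a dominant alcove. -/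
def Wplus : Set (V ≃ᵃ[ℝ] V) :=
  {g | g ∈ S.extAff ∧ ∀ x ∈ S.A0, ∀ α ∈ S.Δ, 0 < S.coroot α (g x)}

/-- `W̃₁`: the elements of `W̃` taking the base alcove to a restricted alcove. -/
def Wone : Set (V ≃ᵃ[ℝ] V) :=
  {g | g ∈ S.extAff ∧ ∀ x ∈ S.A0, ∀ α ∈ S.Δ,
    0 < S.coroot α (g x) ∧ S.coroot α (g x) < 1}

/-- `w̃_h = w₀ t_{-η}`. -/
noncomputable def wh : V ≃ᵃ[ℝ] V := S.ofW S.w0 * S.trans (-S.eta)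

/-- The lowest `p`-alcove `C₀`. -/
def C0 (p : ℕ) : Set V :=
  {x | ∀ α ∈ S.Rpos, 0 < S.coroot α (x + S.eta) ∧ S.coroot α (x + S.eta) < (p : ℝ)}

/-- The root lattice `ℤR`. -/
def rootLattice : AddSubgroup V := AddSubgroup.closure (S.R : Set V)

/-- `Ω`: the stabilizer of the base alcove in `W̃`. -/
def Omega : Set (V ≃ᵃ[ℝ] V) := {g | g ∈ S.extAff ∧ g '' S.A0 = S.A0}

/-- The `λ`-admissible set `Adm(λ) = ⋃_{w ∈ W} W̃_{≤ t_{w(λ)}}`. -/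
def Adm (lam : V) : Set (V ≃ᵃ[ℝ] V) :=
  {g | ∃ w ∈ S.Weyl, S.bruhatLE g (S.trans (w lam))}

/-- `α∨` is a highest coroot, i.e. the highest root of an irreducible component of the
dual root system `R∨`: equivalently, `α∨` is a dominant coroot and no simple coroot can
be added to `α∨` to yield a coroot. -/
def IsHighestCoroot (α : V) : Prop :=
  α ∈ S.R ∧ (∀ β ∈ S.Δ, 0 ≤ S.coroot α β) ∧
    ∀ β ∈ S.Δ, ∀ γ ∈ S.R, S.coroot γ ≠ S.coroot α + S.coroot β

section RootSystem

/-- The canonical Weyl-invariant form `∑ ⟨x,δ∨⟩⟨y,δ∨⟩`, summed over all roots `δ`. -/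
noncomputable def canonicalForm (x y : V) : ℝ := ∑ δ ∈ S.R, S.coroot δ x * S.coroot δ y

theorem simple_mem_R {γ : V} (hγ : γ ∈ S.Δ) : γ ∈ S.R :=
  S.pos_subset (S.simple_subset hγ)

theorem reflect_reflect {α : V} (hα : α ∈ S.R) (x : V) :
    (x - S.coroot α x • α) - S.coroot α (x - S.coroot α x • α) • α = x := by
  have h : S.coroot α (x - S.coroot α x • α) = - S.coroot α x := by
    rw [map_sub, map_smul, S.coroot_self α hα, smul_eq_mul]; ring
  rw [h, neg_smul]; abel

theorem coroot_reflect_reflect {α β : V} (hα : α ∈ S.R) (hβ : β ∈ S.R) (x : V) :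
    S.coroot (β - S.coroot α β • α) (x - S.coroot α x • α) = S.coroot β x := by
  rw [S.reflect_coroot α hα β hβ]
  simp only [map_sub, map_smul, smul_eq_mul, S.coroot_self α hα]
  ring

theorem canonicalForm_reflect {α : V} (hα : α ∈ S.R) (x y : V) :
    S.canonicalForm (x - S.coroot α x • α) (y - S.coroot α y • α) = S.canonicalForm x y := by
  unfold canonicalForm
  refine Finset.sum_nbij' (fun δ => δ - S.coroot α δ • α) (fun δ => δ - S.coroot α δ • α)
    (fun δ hδ => S.reflect_root α hα δ hδ) (fun δ hδ => S.reflect_root α hα δ hδ)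
    (fun δ _ => S.reflect_reflect hα δ) (fun δ _ => S.reflect_reflect hα δ) fun δ hδ => ?_
  have h (z : V) : S.coroot (δ - S.coroot α δ • α) z = S.coroot δ (z - S.coroot α z • α) := by
    rw [S.reflect_coroot α hα δ hδ, map_sub, map_smul, smul_eq_mul]; ring
  rw [h, h]

theorem two_mul_canonicalForm_root {α : V} (hα : α ∈ S.R) (x : V) :
    2 * S.canonicalForm α x = S.canonicalForm α α * S.coroot α x := by
  have h := S.canonicalForm_reflect hα α x
  have e : S.canonicalForm (α - S.coroot α α • α) (x - S.coroot α x • α)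
      = - S.canonicalForm α x + S.coroot α x * S.canonicalForm α α := by
    unfold canonicalForm
    rw [Finset.mul_sum, ← Finset.sum_neg_distrib, ← Finset.sum_add_distrib]
    refine Finset.sum_congr rfl fun δ _ => ?_
    simp only [map_sub, map_smul, smul_eq_mul, S.coroot_self α hα]
    ring
  linarith

theorem canonicalForm_root_self_pos {α : V} (hα : α ∈ S.R) : 0 < S.canonicalForm α α := by
  unfold canonicalForm
  refine Finset.sum_pos' (fun δ _ => mul_self_nonneg _) ⟨α, hα, ?_⟩
  rw [S.coroot_self α hα]; norm_num

theorem exists_coroot_eq_sum_simple {β : V} (hβ : β ∈ S.Rpos) :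
    ∃ d : V → ℝ, (∀ γ ∈ S.Δ, 0 ≤ d γ) ∧
      ∀ x, S.coroot β x = ∑ γ ∈ S.Δ, d γ * S.coroot γ x := by
  obtain ⟨c, hc⟩ := S.pos_sum_simple β hβ
  have hβR := S.pos_subset hβ
  have hβpos := S.canonicalForm_root_self_pos hβR
  refine ⟨fun γ => c γ * S.canonicalForm γ γ / S.canonicalForm β β, fun γ hγ => ?_, fun x => ?_⟩
  · have := S.canonicalForm_root_self_pos (S.simple_mem_R hγ)
    positivity
  · have h1 := S.two_mul_canonicalForm_root hβR x
    have h2 : S.canonicalForm β x = ∑ γ ∈ S.Δ, c γ * S.canonicalForm γ x := by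
      simp only [canonicalForm, Finset.mul_sum]
      rw [Finset.sum_comm]
      refine Finset.sum_congr rfl fun δ _ => ?_
      conv_lhs => rw [hc]
      rw [map_sum, Finset.sum_mul]
      refine Finset.sum_congr rfl fun γ _ => ?_
      rw [map_smul, smul_eq_mul, mul_assoc]
    have h3 : S.canonicalForm β β * S.coroot β x
        = ∑ γ ∈ S.Δ, c γ * S.canonicalForm γ γ * S.coroot γ x := by
      rw [← h1, h2, Finset.mul_sum]
      refine Finset.sum_congr rfl fun γ hγ => ?_
      rw [mul_assoc, ← S.two_mul_canonicalForm_root (S.simple_mem_R hγ)]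
      ring
    rw [eq_div_of_mul_eq hβpos.ne' ((mul_comm _ _).trans h3), Finset.sum_div]
    exact Finset.sum_congr rfl fun γ _ => by ring

theorem coroot_le_of_simple {x y : V} (h : ∀ γ ∈ S.Δ, S.coroot γ x ≤ S.coroot γ y)
    {β : V} (hβ : β ∈ S.Rpos) : S.coroot β x ≤ S.coroot β y := by
  obtain ⟨d, hd, hs⟩ := S.exists_coroot_eq_sum_simple hβ
  rw [hs, hs]
  exact Finset.sum_le_sum fun γ hγ => mul_le_mul_of_nonneg_left (h γ hγ) (hd γ hγ)

theorem coroot_eta_pos {β : V} (hβ : β ∈ S.Rpos) : 0 < S.coroot β S.eta := by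
  obtain ⟨d, hd, hs⟩ := S.exists_coroot_eq_sum_simple hβ
  have he : S.coroot β S.eta = ∑ γ ∈ S.Δ, d γ := by
    rw [hs]
    exact Finset.sum_congr rfl fun γ hγ => by rw [S.eta_pair γ hγ, mul_one]
  rw [he]
  refine (Finset.sum_nonneg hd).lt_of_ne fun h0 => ?_
  have hz := (Finset.sum_eq_zero_iff_of_nonneg hd).1 h0.symm
  have h2 := S.coroot_self β (S.pos_subset hβ)
  rw [hs, Finset.sum_eq_zero fun γ hγ => by rw [hz γ hγ, zero_mul]] at h2
  norm_num at h2

theorem A0_nonempty : S.A0.Nonempty := by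
  set M : ℝ := 1 + ∑ β ∈ S.Rpos, S.coroot β S.eta
  have hnn : ∀ β ∈ S.Rpos, 0 ≤ S.coroot β S.eta := fun β hβ => (S.coroot_eta_pos hβ).le
  have hM : 0 < M := add_pos_of_pos_of_nonneg one_pos (Finset.sum_nonneg hnn)
  refine ⟨M⁻¹ • S.eta, fun β hβ => ?_⟩
  have hlt : S.coroot β S.eta < M := by
    have := Finset.single_le_sum hnn hβ
    simp only [M]; linarith
  rw [map_smul, smul_eq_mul]
  refine ⟨mul_pos (inv_pos.2 hM) (S.coroot_eta_pos hβ), ?_⟩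
  rw [inv_mul_lt_iff₀ hM, mul_one]
  exact hlt

theorem coroot_simple_simple_nonpos {γ α : V} (hγ : γ ∈ S.Δ) (hα : α ∈ S.Δ) (hne : γ ≠ α) :
    S.coroot γ α ≤ 0 := by
  have hli : ∀ b : V → ℝ, ∑ β ∈ S.Δ, b β • β = 0 → ∀ β ∈ S.Δ, b β = 0 := by
    intro b hb β hβ
    have h := Fintype.linearIndependent_iff.1 S.simple_indep (fun β => b β)
    rw [← Finset.sum_coe_sort] at hb
    exact h hb ⟨β, hβ⟩
  have hcoeff : ∀ (e : V → ℝ), (α - S.coroot γ α • γ = ∑ β ∈ S.Δ, e β • β) →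
      e α = 1 ∧ e γ = - S.coroot γ α := by
    intro e he
    have hz : ∑ β ∈ S.Δ, (e β - ((if β = α then 1 else 0)
        - (if β = γ then S.coroot γ α else 0))) • β = 0 := by
      simp [sub_smul, Finset.sum_sub_distrib, ite_smul, hα, hγ, ← he]
    have h1 := hli _ hz α hα
    have h2 := hli _ hz γ hγ
    simp only [hne, hne.symm, if_true, if_false] at h1 h2
    exact ⟨by linarith, by linarith⟩
  have hR := S.reflect_root γ (S.simple_mem_R hγ) α (S.simple_mem_R hα)
  rcases S.pos_or_neg _ hR with h | h
  · obtain ⟨c, hc⟩ := S.pos_sum_simple _ h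
    have := (hcoeff _ hc).2
    have hc0 : (0 : ℝ) ≤ c γ := Nat.cast_nonneg _
    linarith
  · obtain ⟨c, hc⟩ := S.pos_sum_simple _ h
    have := (hcoeff (fun β => -(c β : ℝ)) (by
      simp only [neg_smul, Finset.sum_neg_distrib, ← hc, neg_neg])).1
    have hc0 : (0 : ℝ) ≤ c α := Nat.cast_nonneg _
    linarith

end RootSystem

section AffineAction

/-- `g` permutes the affine functions `⟨·,β∨⟩ - n`, through its linear part on `β`. -/
def PreservesAffineRoots (g : V ≃ᵃ[ℝ] V) : Prop :=
  ∀ β ∈ S.R, g.linear β ∈ S.R ∧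
    ∃ m : ℤ, ∀ x, S.coroot (g.linear β) (g x) = S.coroot β x + m

variable {S}

theorem PreservesAffineRoots.mul {g h : V ≃ᵃ[ℝ] V} (hg : S.PreservesAffineRoots g)
    (hh : S.PreservesAffineRoots h) : S.PreservesAffineRoots (g * h) := by
  intro β hβ
  obtain ⟨h1, m, hm⟩ := hh β hβ
  obtain ⟨h2, k, hk⟩ := hg _ h1
  refine ⟨h2, m + k, fun x => ?_⟩
  have := hk (h x)
  rw [hm] at this
  push_cast
  rw [← add_assoc]
  exact this

theorem PreservesAffineRoots.exists_linear_eq {g : V ≃ᵃ[ℝ] V} (hg : S.PreservesAffineRoots g)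
    {β : V} (hβ : β ∈ S.R) : ∃ γ ∈ S.R, g.linear γ = β := by
  have h : Set.SurjOn g.linear S.R S.R :=
    Finset.surjOn_of_injOn_of_card_le g.linear (fun γ hγ => (hg γ hγ).1)
      g.linear.injective.injOn le_rfl
  exact h hβ

theorem PreservesAffineRoots.inv {g : V ≃ᵃ[ℝ] V} (hg : S.PreservesAffineRoots g) :
    S.PreservesAffineRoots g⁻¹ := by
  intro β hβ
  obtain ⟨γ, hγ, rfl⟩ := hg.exists_linear_eq hβ
  obtain ⟨-, m, hm⟩ := hg γ hγ
  have hl : (g⁻¹).linear (g.linear γ) = γ := g.linear.symm_apply_apply γ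
  rw [hl]
  refine ⟨hγ, -m, fun x => ?_⟩
  have := hm (g⁻¹ x)
  rw [show g (g⁻¹ x) = x from g.apply_symm_apply x] at this
  push_cast
  linarith

variable (S)

theorem preservesAffineRoots_trans {ν : V} (hν : ν ∈ S.X) :
    S.PreservesAffineRoots (S.trans ν) := by
  intro β hβ
  obtain ⟨m, hm⟩ := S.coroot_int β hβ ν hν
  refine ⟨hβ, m, fun x => ?_⟩
  change S.coroot β (ν + x) = _
  rw [map_add, hm, add_comm]

theorem preservesAffineRoots_ofW {w : V ≃ₗ[ℝ] V} (hw : w ∈ S.Weyl) :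
    S.PreservesAffineRoots (S.ofW w) := by
  induction hw using Subgroup.closure_induction with
  | mem w h =>
    obtain ⟨α, hα, h⟩ := h
    intro β hβ
    change w β ∈ S.R ∧ ∃ m : ℤ, ∀ x, S.coroot (w β) (w x) = _
    rw [h β]
    refine ⟨S.reflect_root α hα β hβ, 0, fun x => ?_⟩
    rw [h x, S.coroot_reflect_reflect hα hβ, Int.cast_zero, add_zero]
  | one => exact fun β hβ => ⟨hβ, 0, fun x => by
      rw [Int.cast_zero, add_zero]; rfl⟩
  | mul w v _ _ hw hv => exact hw.mul hv
  | inv w _ hw => exact hw.inv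

theorem preservesAffineRoots_of_mem_extAff {g : V ≃ᵃ[ℝ] V} (hg : g ∈ S.extAff) :
    S.PreservesAffineRoots g := by
  obtain ⟨ν, hν, w, hw, rfl⟩ := hg
  exact (S.preservesAffineRoots_trans hν).mul (S.preservesAffineRoots_ofW hw)

theorem coroot_weyl {w : V ≃ₗ[ℝ] V} (hw : w ∈ S.Weyl) {β : V} (hβ : β ∈ S.R) (x : V) :
    S.coroot (w β) (w x) = S.coroot β x := by
  obtain ⟨-, m, hm⟩ := S.preservesAffineRoots_ofW hw β hβ
  have h0 := hm 0
  have hx := hm x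
  change S.coroot (w β) (w 0) = _ at h0
  change S.coroot (w β) (w x) = _ at hx
  simp only [map_zero, zero_add] at h0
  rw [hx, ← h0, add_zero]

theorem coroot_w0_neg {β a : V} (hβ : β ∈ S.Rpos) (ha : a ∈ S.A0) :
    S.coroot β (S.w0 a) < 0 := by
  have hw : S.w0 ∈ S.Weyl := S.w0_mem
  obtain ⟨γ, hγ, rfl⟩ :=
    (S.preservesAffineRoots_ofW hw).exists_linear_eq (S.pos_subset hβ)
  change S.w0 γ ∈ S.Rpos at hβ
  change S.coroot (S.w0 γ) (S.w0 a) < 0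
  rw [S.coroot_weyl hw hγ]
  rcases S.pos_or_neg γ hγ with h | h
  · exact absurd (S.w0_neg γ h) (S.pos_not_neg _ hβ)
  · have := (ha _ h).1
    rw [S.coroot_neg γ hγ, LinearMap.neg_apply] at this
    linarith

theorem exists_floor_A0 {β : V} (hβ : β ∈ S.R) :
    ∃ k : ℤ, ∀ x ∈ S.A0, (k : ℝ) < S.coroot β x ∧ S.coroot β x < k + 1 := by
  rcases S.pos_or_neg β hβ with h | h
  · exact ⟨0, fun x hx => by simpa using hx β h⟩
  · refine ⟨-1, fun x hx => ?_⟩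
    have := hx _ h
    rw [S.coroot_neg β hβ, LinearMap.neg_apply] at this
    push_cast
    constructor <;> linarith

variable {S}

theorem PreservesAffineRoots.exists_floor {g : V ≃ᵃ[ℝ] V} (hg : S.PreservesAffineRoots g)
    {β : V} (hβ : β ∈ S.R) :
    ∃ k : ℤ, ∀ x ∈ S.A0, (k : ℝ) < S.coroot β (g x) ∧ S.coroot β (g x) < k + 1 := by
  obtain ⟨γ, hγ, rfl⟩ := hg.exists_linear_eq hβ
  obtain ⟨-, m, hm⟩ := hg γ hγ
  obtain ⟨k, hk⟩ := S.exists_floor_A0 hγ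
  refine ⟨k + m, fun x hx => ?_⟩
  have := hk x hx
  rw [hm]
  push_cast
  constructor <;> linarith

theorem PreservesAffineRoots.coroot_ne_intCast {g : V ≃ᵃ[ℝ] V} (hg : S.PreservesAffineRoots g)
    {β a : V} (hβ : β ∈ S.R) (ha : a ∈ S.A0) (n : ℤ) : S.coroot β (g a) ≠ n := by
  obtain ⟨k, hk⟩ := hg.exists_floor hβ
  intro h
  obtain ⟨h1, h2⟩ := hk a ha
  rw [h] at h1 h2
  norm_cast at h1 h2
  omega

theorem PreservesAffineRoots.coroot_lt_intCast {g : V ≃ᵃ[ℝ] V} (hg : S.PreservesAffineRoots g)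
    {β a b : V} (hβ : β ∈ S.R) (ha : a ∈ S.A0) (hb : b ∈ S.A0) {n : ℤ}
    (h : S.coroot β (g a) < n) : S.coroot β (g b) < n := by
  obtain ⟨k, hk⟩ := hg.exists_floor hβ
  have h1 : k + 1 ≤ n := by
    have : (k : ℝ) < n := (hk a ha).1.trans h
    exact_mod_cast this
  exact (hk b hb).2.trans_le (by exact_mod_cast h1)

theorem PreservesAffineRoots.intCast_lt_coroot {g : V ≃ᵃ[ℝ] V} (hg : S.PreservesAffineRoots g)
    {β a b : V} (hβ : β ∈ S.R) (ha : a ∈ S.A0) (hb : b ∈ S.A0) {n : ℤ}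
    (h : n < S.coroot β (g a)) : n < S.coroot β (g b) := by
  by_contra hn
  have := (not_lt.1 hn).lt_of_ne (hg.coroot_ne_intCast hβ hb n)
  exact lt_asymm h (hg.coroot_lt_intCast hβ hb ha this)

variable (S)

theorem preservesAffineRoots_one : S.PreservesAffineRoots 1 :=
  fun β hβ => ⟨hβ, 0, fun x => by
    rw [Int.cast_zero, add_zero]; rfl⟩

theorem separates_iff {g : V ≃ᵃ[ℝ] V} (hg : S.PreservesAffineRoots g) {β a : V}
    (hβ : β ∈ S.R) (ha : a ∈ S.A0) (n : ℤ) :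
    S.Separates β n g ↔
      (S.coroot β a < n ∧ n < S.coroot β (g a)) ∨ (n < S.coroot β a ∧ S.coroot β (g a) < n) := by
  have h1 := S.preservesAffineRoots_one
  constructor
  · rintro (⟨h, h'⟩ | ⟨h, h'⟩)
    · exact Or.inl ⟨h a ha, h' a ha⟩
    · exact Or.inr ⟨h a ha, h' a ha⟩
  · rintro (⟨h, h'⟩ | ⟨h, h'⟩)
    · exact Or.inl ⟨fun x hx => h1.coroot_lt_intCast hβ ha hx h,
        fun x hx => hg.intCast_lt_coroot hβ ha hx h'⟩
    · exact Or.inr ⟨fun x hx => h1.intCast_lt_coroot hβ ha hx h,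
        fun x hx => hg.coroot_lt_intCast hβ ha hx h'⟩

end AffineAction

section Length

/-- The affine roots `⟨·,β∨⟩ - n`, with `β` any root, that are negative at `u` and positive
at `v`. -/
def sepSet (u v : V) : Set (V × ℤ) :=
  {q | q.1 ∈ S.R ∧ S.coroot q.1 u < q.2 ∧ q.2 < S.coroot q.1 v}

theorem sepSet_finite (u v : V) : (S.sepSet u v).Finite := by
  have h : (⋃ β ∈ S.R, (fun n : ℤ => (β, n)) ''
      Set.Icc ⌊S.coroot β u⌋ ⌈S.coroot β v⌉).Finite :=
    S.R.finite_toSet.biUnion fun β _ => (Set.finite_Icc _ _).image _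
  refine h.subset ?_
  rintro ⟨β, n⟩ ⟨hβ, h1, h2⟩
  simp only [Set.mem_iUnion]
  exact ⟨β, hβ, n, ⟨Int.cast_le.1 ((Int.floor_le _).trans h1.le),
    Int.cast_le.1 (h2.le.trans (Int.le_ceil _))⟩, rfl⟩

theorem ncard_sepSet_le {g : V ≃ᵃ[ℝ] V} (hg : S.PreservesAffineRoots g) (u v : V) :
    (S.sepSet u v).ncard ≤ (S.sepSet (g u) (g v)).ncard := by
  choose hmem m hm using hg
  refine Set.ncard_le_ncard_of_injOn
    (fun q => (g.linear q.1, if h : q.1 ∈ S.R then q.2 + m q.1 h else 0)) ?_ ?_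
    (S.sepSet_finite _ _)
  · rintro ⟨β, n⟩ ⟨hβ, h1, h2⟩
    simp only at hβ h1 h2
    simp only [hβ, dif_pos, sepSet, Set.mem_ofPred_eq, hm, hmem, true_and]
    push_cast
    constructor <;> linarith
  · rintro ⟨β, n⟩ ⟨hβ, -⟩ ⟨β', n'⟩ ⟨hβ', -⟩ h
    simp only at hβ hβ'
    simp only [Prod.mk.injEq, hβ, hβ', dif_pos] at h
    obtain ⟨h1, h2⟩ := h
    obtain rfl := g.linear.injective h1
    rw [add_right_cancel h2]

theorem ncard_sepSet {g : V ≃ᵃ[ℝ] V} (hg : S.PreservesAffineRoots g) (u v : V) :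
    (S.sepSet (g u) (g v)).ncard = (S.sepSet u v).ncard := by
  refine le_antisymm ?_ (S.ncard_sepSet_le hg u v)
  have h := S.ncard_sepSet_le hg.inv (g u) (g v)
  rwa [show g⁻¹ (g u) = u from g.symm_apply_apply u,
    show g⁻¹ (g v) = v from g.symm_apply_apply v] at h

theorem len_eq_ncard_sepSet {g : V ≃ᵃ[ℝ] V} (hg : S.PreservesAffineRoots g) {a : V}
    (ha : a ∈ S.A0) : S.len g = (S.sepSet a (g a)).ncard := by
  unfold len
  refine Set.ncard_congr
    (fun q _ => if S.coroot q.1 a < q.2 then q else (-q.1, -q.2)) ?_ ?_ ?_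
  · rintro ⟨β, n⟩ ⟨hβ, hs⟩
    have hR := S.pos_subset hβ
    simp only at hβ hs
    rw [S.separates_iff hg hR ha] at hs
    rcases hs with hs | hs
    · simp only [hs.1, if_true]
      exact ⟨hR, hs⟩
    · simp only [hs.1.not_gt, if_false]
      refine ⟨S.neg_mem β hR, ?_⟩
      simp only [S.coroot_neg β hR, LinearMap.neg_apply, Int.cast_neg]
      constructor <;> linarith
  · rintro ⟨β, n⟩ ⟨β', n'⟩ ⟨hβ, -⟩ ⟨hβ', -⟩ h
    simp only at hβ hβ' h
    split_ifs at h
    · exact h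
    · obtain ⟨rfl, -⟩ := Prod.mk.inj h
      exact absurd hβ (S.pos_not_neg _ hβ')
    · obtain ⟨rfl, -⟩ := Prod.mk.inj h
      exact absurd hβ' (S.pos_not_neg _ hβ)
    · obtain ⟨h1, h2⟩ := Prod.mk.inj h
      rw [neg_inj.1 h1, neg_inj.1 h2]
  · rintro ⟨β, n⟩ ⟨hR, h1, h2⟩
    simp only at hR h1 h2
    rcases S.pos_or_neg β hR with hβ | hβ
    · exact ⟨(β, n), ⟨hβ, (S.separates_iff hg hR ha n).2 (Or.inl ⟨h1, h2⟩)⟩, if_pos h1⟩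
    · have hc := S.coroot_neg β hR
      have h1' : ((-n : ℤ) : ℝ) < S.coroot (-β) a := by
        rw [hc, LinearMap.neg_apply, Int.cast_neg]; linarith
      refine ⟨(-β, -n), ⟨hβ, (S.separates_iff hg (S.neg_mem β hR) ha _).2
        (Or.inr ⟨h1', ?_⟩)⟩, ?_⟩
      · rw [hc, LinearMap.neg_apply, Int.cast_neg]; linarith
      · simp only [h1'.not_gt, if_false, neg_neg]

/-- If no affine root hyperplane separates `A₀` from both `d(A₀)` and `dg(A₀)`, then the
factorization `d⁻¹ · (dg)` is reduced. -/
theorem len_eq_add_of_not_separates {d g : V ≃ᵃ[ℝ] V} (hd : S.PreservesAffineRoots d)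
    (hg : S.PreservesAffineRoots g) {a : V} (ha : a ∈ S.A0)
    (hlt : ∀ β ∈ S.Rpos, ∀ n : ℤ, S.coroot β a < n → n < S.coroot β (d a) →
      S.coroot β (d (g a)) ≤ n)
    (hgt : ∀ β ∈ S.Rpos, ∀ n : ℤ, n < S.coroot β a → S.coroot β (d a) < n →
      n ≤ S.coroot β (d (g a))) :
    S.len g = S.len d⁻¹ + S.len (d * g) := by
  have hdg := hd.mul hg
  have hlt' : ∀ β ∈ S.R, ∀ n : ℤ, S.coroot β a < n → n < S.coroot β (d a) →
      S.coroot β (d (g a)) < n := by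
    intro β hβ n h1 h2
    refine lt_of_le_of_ne ?_ (hdg.coroot_ne_intCast hβ ha n)
    change S.coroot β (d (g a)) ≤ n
    rcases S.pos_or_neg β hβ with h | h
    · exact hlt β h n h1 h2
    · have := hgt _ h (-n)
      simp only [S.coroot_neg β hβ, LinearMap.neg_apply, Int.cast_neg] at this
      linarith [this (by linarith) (by linarith)]
  have hgt' : ∀ β ∈ S.R, ∀ n : ℤ, n < S.coroot β a → S.coroot β (d a) < n →
      n < S.coroot β (d (g a)) := by
    intro β hβ n h1 h2
    have := hlt' _ (S.neg_mem β hβ) (-n)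
    simp only [S.coroot_neg β hβ, LinearMap.neg_apply, Int.cast_neg] at this
    linarith [this (by linarith) (by linarith)]
  rw [S.len_eq_ncard_sepSet hg ha, S.len_eq_ncard_sepSet hd.inv ha,
    S.len_eq_ncard_sepSet hdg ha, ← S.ncard_sepSet hd a (g a),
    ← S.ncard_sepSet hd a (d⁻¹ a), show d (d⁻¹ a) = a from d.apply_symm_apply a]
  have hunion : (S.sepSet (d a) (d (g a))) = S.sepSet (d a) a ∪ S.sepSet a (d (g a)) := by
    ext ⟨β, n⟩
    simp only [sepSet, Set.mem_ofPred_eq, Set.mem_union]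
    constructor
    · rintro ⟨hβ, h1, h2⟩
      rcases lt_or_gt_of_ne (S.preservesAffineRoots_one.coroot_ne_intCast hβ ha n) with h | h
      · exact Or.inr ⟨hβ, h, h2⟩
      · exact Or.inl ⟨hβ, h1, h⟩
    · rintro (⟨hβ, h1, h2⟩ | ⟨hβ, h1, h2⟩)
      · exact ⟨hβ, h1, hgt' β hβ n h2 h1⟩
      · refine ⟨hβ, ?_, h2⟩
        refine lt_of_le_of_ne ?_ (hd.coroot_ne_intCast hβ ha n)
        by_contra h
        exact lt_asymm h2 (hlt' β hβ n h1 (not_le.1 h))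
  rw [hunion, Set.ncard_union_eq ?_ (S.sepSet_finite _ _) (S.sepSet_finite _ _)]
  · rfl
  · rw [Set.disjoint_left]
    rintro ⟨β, n⟩ ⟨-, -, h⟩ ⟨-, h', -⟩
    exact lt_asymm h h'

end Length

end Ctx


/-- Lemma `reduced2`: the factorization
`(s_α w̃₂)^{⋄,-1} ⋅ ((s_α w̃₂)^⋄ w̃₂⁻¹ s_α w₀)` of `w̃₂⁻¹ s_α w₀` is reduced, where
`(s_α w̃₂)^⋄ = t_ω s_α w̃₂ ∈ W̃₁` and `h_{ω_α} = 1`. -/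
theorem statement2 {V : Type} [AddCommGroup V] [Module ℝ V] [FiniteDimensional ℝ V]
    (S : Ctx V)
    (α : V) (hα : α ∈ S.Δ)
    (ωα : V) (hωαX : ωα ∈ S.X)
    (hωαf : ∀ β ∈ S.Δ, S.coroot β ωα = if β = α then 1 else 0)
    (hωαh : ∀ β ∈ S.R, S.coroot β ωα ≤ 1)
    (sα : V ≃ₗ[ℝ] V) (hsα : ∀ x, sα x = x - S.coroot α x • α)
    (w₂ : V ≃ᵃ[ℝ] V) (hw₂ : w₂ ∈ S.Wone)
    (ω : V) (hω : ω ∈ S.X)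
    (hdia : S.trans ω * (S.ofW sα * w₂) ∈ S.Wone) :
    S.len (w₂⁻¹ * (S.ofW sα * S.ofW S.w0))
      = S.len (S.trans ω * (S.ofW sα * w₂))⁻¹
        + S.len ((S.trans ω * (S.ofW sα * w₂)) * (w₂⁻¹ * (S.ofW sα * S.ofW S.w0))) := by
  obtain ⟨a, ha⟩ := S.A0_nonempty
  have hαR := S.simple_mem_R hα
  have hsW : sα ∈ S.Weyl := Subgroup.subset_closure ⟨α, hαR, hsα⟩
  have hd := S.preservesAffineRoots_of_mem_extAff hdia.1
  have hg : S.PreservesAffineRoots (w₂⁻¹ * (S.ofW sα * S.ofW S.w0)) :=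
    (S.preservesAffineRoots_of_mem_extAff hw₂.1).inv.mul
      ((S.preservesAffineRoots_ofW hsW).mul (S.preservesAffineRoots_ofW S.w0_mem))
  have hda : (S.trans ω * (S.ofW sα * w₂)) a = ω + sα (w₂ a) := rfl
  have hdga : (S.trans ω * (S.ofW sα * w₂)) ((w₂⁻¹ * (S.ofW sα * S.ofW S.w0)) a)
      = ω + S.w0 a := by
    change ω + sα (w₂ (w₂.symm (sα (S.w0 a)))) = _
    rw [w₂.apply_symm_apply, hsα (sα _), hsα (S.w0 a), S.reflect_reflect hαR]
  have hω_simple : ∀ γ ∈ S.Δ, S.coroot γ ω ≤ S.coroot γ ωα := by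
    intro γ hγ
    obtain ⟨m, hm⟩ := S.coroot_int γ (S.simple_mem_R hγ) ω hω
    have h1 := (hdia.2 a ha γ hγ).2
    have h2 := hw₂.2 a ha γ hγ
    have h3 := hw₂.2 a ha α hα
    rw [hda, map_add, hsα, map_sub, map_smul, smul_eq_mul, hm] at h1
    rw [hωαf γ hγ, hm]
    split_ifs with h
    · subst h
      rw [S.coroot_self γ hαR] at h1
      have : (m : ℝ) < 2 := by linarith
      have : m < 2 := by exact_mod_cast this
      exact_mod_cast (by omega : m ≤ 1)
    · have h4 := S.coroot_simple_simple_nonpos hγ hα h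
      have : (m : ℝ) < 1 := by nlinarith
      have : m < 1 := by exact_mod_cast this
      exact_mod_cast (by omega : m ≤ 0)
  refine S.len_eq_add_of_not_separates hd hg ha (fun β hβ n h1 _ => ?_) fun β hβ n h1 h2 => ?_
  · have hn : (0 : ℝ) < n := (ha β hβ).1.trans h1
    have hn' : (1 : ℝ) ≤ n := by exact_mod_cast hn
    rw [hdga, map_add]
    linarith [S.coroot_le_of_simple hω_simple hβ, hωαh β (S.pos_subset hβ),
      S.coroot_w0_neg hβ ha]
  · have hpos : 0 ≤ S.coroot β ((S.trans ω * (S.ofW sα * w₂)) a) := by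
      have := S.coroot_le_of_simple (x := 0)
        (fun γ hγ => (map_zero (S.coroot γ)).trans_le (hdia.2 a ha γ hγ).1.le) hβ
      rwa [map_zero] at this
    have hn : (0 : ℝ) < n := hpos.trans_lt h2
    have hn' : (1 : ℝ) ≤ n := by exact_mod_cast hn
    linarith [(ha β hβ).2]

end SerrePaper
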